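/- Let D be an EAS division ring, p, q ≥ 2 be integers, and φ : M_2(D) → M_{p×q}(D) be an adjacency preserver. Assume there exists a nonzero scalar α ∈ D such that: φ([[a, 0],[b, 0]]) = [[[[a, 0],[b, 0]], 0],[0, 0]] for all a, b ∈ D (i.e. the image is the p×q matrix with 2×2 upper-left block [[a,0],[b,0]] and zeros elsewhere); φ([[0, 1],[0, 0]]) = [[[[0, 1],[0, 0]], 0],[0, 0]]; and φ([[0, 0],[0, 1]]) = [[[[0, 0],[0, α]], 0],[0, 0]]. Then φ(A) = [[A, 0],[0, 0]] for every A ∈ M_2(D). -/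

import Mathlib

open Matrix

variable {D : Type*} [DivisionRing D]

/-- The rank of a matrix over a division ring: the dimension of its row space,
i.e. of the left `D`-subspace of `D^n` spanned by the rows. -/
noncomputable def rowRank {m n : ℕ} (A : Matrix (Fin m) (Fin n) D) : ℕ :=
  Module.finrank D (Submodule.span D (Set.range fun i => A i))

/-- Two matrices are adjacent if their difference has rank one. -/
def Adjacent {m n : ℕ} (A B : Matrix (Fin m) (Fin n) D) : Prop :=
  rowRank (A - B) = 1

/-- `R(x)`: the set of matrices of the form `ᵗu x` for a fixed row vector `x`. -/
def Rvec {m n : ℕ} (x : Fin n → D) : Set (Matrix (Fin m) (Fin n) D) :=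
  { M | ∃ u : Fin m → D, ∀ i j, M i j = u i * x j }

/-- `L(ᵗy)`: the set of matrices of the form `ᵗy v` for a fixed column vector `ᵗy`. -/
def Lvec {m n : ℕ} (y : Fin m → D) : Set (Matrix (Fin m) (Fin n) D) :=
  { M | ∃ v : Fin n → D, ∀ i j, M i j = y i * v j }

/-- `R_d`: the matrices whose row space is contained in `d`. -/
def Rsub {m n : ℕ} (d : Submodule D (Fin n → D)) : Set (Matrix (Fin m) (Fin n) D) :=
  { M | ∀ i, M i ∈ d }

/-- `L_e`: the matrices whose column space (a right subspace, i.e. a `Dᵐᵒᵖ`-submodule)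
is contained in `e`. -/
def Lsub {m n : ℕ} (e : Submodule Dᵐᵒᵖ (Fin m → D)) : Set (Matrix (Fin m) (Fin n) D) :=
  { M | ∀ j, (fun i => M i j) ∈ e }

/-- The orthogonal set of a set `e` of column vectors. -/
def perpSet {m : ℕ} (e : Set (Fin m → D)) : Set (Fin m → D) :=
  { u | ∀ v ∈ e, ∑ i, u i * v i = 0 }

/-- The `p × q` matrix with upper-left block `B` and zeros elsewhere. -/
def pad {m n : ℕ} (p q : ℕ) (B : Matrix (Fin m) (Fin n) D) :
    Matrix (Fin p) (Fin q) D :=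
  Matrix.of fun i j =>
    if hi : (i : ℕ) < m then if hj : (j : ℕ) < n then B ⟨i, hi⟩ ⟨j, hj⟩ else 0 else 0

/-- `φ` is degenerate with respect to `A`. -/
def DegenerateAt {m n p q : ℕ} (φ : Matrix (Fin m) (Fin n) D → Matrix (Fin p) (Fin q) D)
    (A : Matrix (Fin m) (Fin n) D) : Prop :=
  ∃ x : Fin p → D, x ≠ 0 ∧ ∃ y : Fin q → D, y ≠ 0 ∧
    ∀ M : Matrix (Fin m) (Fin n) D, rowRank M ≤ 1 →
      φ (A + M) - φ A ∈ Rvec y ∪ Lvec x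

/-- `φ` is degenerate: degenerate with respect to every matrix. -/
def Degenerate {m n p q : ℕ} (φ : Matrix (Fin m) (Fin n) D → Matrix (Fin p) (Fin q) D) :
    Prop :=
  ∀ A, DegenerateAt φ A

/-- A map (sending `0` to `0`) is degenerate with respect to `0` iff it maps every matrix of
rank at most one into `R(y) ∪ L(ᵗx)` for some nonzero `y`, `x`. -/
def DegZero {m n p q : ℕ} (φ : Matrix (Fin m) (Fin n) D → Matrix (Fin p) (Fin q) D) :
    Prop :=
  ∃ x : Fin p → D, x ≠ 0 ∧ ∃ y : Fin q → D, y ≠ 0 ∧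
    ∀ M : Matrix (Fin m) (Fin n) D, rowRank M ≤ 1 → φ M ∈ Rvec y ∪ Lvec x

/-- A standard adjacency preserver. -/
def Standard {m n p q : ℕ} (φ : Matrix (Fin m) (Fin n) D → Matrix (Fin p) (Fin q) D) :
    Prop :=
  (m ≤ p ∧ n ≤ q ∧ ∃ τ : D ≃+* D, ∃ T : Matrix (Fin p) (Fin p) D,
    ∃ S : Matrix (Fin q) (Fin q) D, ∃ R : Matrix (Fin p) (Fin q) D,
    IsUnit T ∧ IsUnit S ∧ ∀ A, φ A = T * pad p q (A.map τ) * S + R) ∨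
  (n ≤ p ∧ m ≤ q ∧ ∃ σ : D → D, Function.Bijective σ ∧ σ 1 = 1 ∧
    (∀ a b, σ (a + b) = σ a + σ b) ∧ (∀ a b, σ (a * b) = σ b * σ a) ∧
    ∃ T : Matrix (Fin p) (Fin p) D, ∃ S : Matrix (Fin q) (Fin q) D,
    ∃ R : Matrix (Fin p) (Fin q) D, IsUnit T ∧ IsUnit S ∧
    ∀ A, φ A = T * pad p q (A.map σ).transpose * S + R)

/-- A division ring is EAS if every (unital) ring endomorphism of it is surjective. -/
def EAS (D : Type*) [DivisionRing D] : Prop :=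
  ∀ f : D →+* D, Function.Surjective f

/-- A set of matrices is adjacent if any two distinct members are adjacent. -/
def IsAdjacentSet {m n : ℕ} (S : Set (Matrix (Fin m) (Fin n) D)) : Prop :=
  ∀ A ∈ S, ∀ B ∈ S, A ≠ B → Adjacent A B

/-- Right linear independence of two column vectors. -/
def RightIndep {n : ℕ} (a b : Fin n → D) : Prop :=
  ∀ s t : D, (∀ i, a i * s + b i * t = 0) → s = 0 ∧ t = 0

/-- A matrix which is the product of a nonzero column and a nonzero row. -/
def IsRankOne {m n : ℕ} (M : Matrix (Fin m) (Fin n) D) : Prop :=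
  ∃ (x : Fin m → D) (y : Fin n → D), x ≠ 0 ∧ y ≠ 0 ∧ ∀ i j, M i j = x i * y j

/-- The two-column matrix with columns `u` and `w`. -/
def twoCols {R : Type*} {m : ℕ} (u w : Fin m → R) : Matrix (Fin m) (Fin 2) R :=
  Matrix.of fun i => ![u i, w i]

/-- A column vector of length two followed by zeros. -/
def extendCol (p : ℕ) (u : Fin 2 → D) : Fin p → D :=
  fun i => if hi : (i : ℕ) < 2 then u ⟨i, hi⟩ else 0

/-- The row vector with a single entry `1`, in position `l`. -/
def unitRow {n : ℕ} (l : Fin n) : Fin n → D := Pi.single l 1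

@[simp]
theorem unitRow_self {n : ℕ} (l : Fin n) : (unitRow l l : D) = 1 := Pi.single_eq_same _ _

theorem unitRow_of_ne {n : ℕ} {l j : Fin n} (h : j ≠ l) : (unitRow l j : D) = 0 :=
  Pi.single_eq_of_ne h _

@[simp]
theorem unitRow_zero_one {n : ℕ} : (unitRow (0 : Fin (n + 2)) 1 : D) = 0 :=
  unitRow_of_ne one_ne_zero

@[simp]
theorem unitRow_one_zero {n : ℕ} : (unitRow (1 : Fin (n + 2)) 0 : D) = 0 :=
  unitRow_of_ne zero_ne_one

theorem rowRank_eq_one_iff {m n : ℕ} (M : Matrix (Fin m) (Fin n) D) :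
    rowRank M = 1 ↔ IsRankOne M := by
  constructor
  · intro h
    obtain ⟨⟨v, hv⟩, hv0, hspan⟩ := finrank_eq_one_iff'.1 h
    have hc : ∀ i, ∃ c : D, c • v = M i := fun i => by
      obtain ⟨c, hc⟩ := hspan ⟨M i, Submodule.subset_span ⟨i, rfl⟩⟩
      exact ⟨c, congrArg Subtype.val hc⟩
    choose x hx using hc
    refine ⟨x, v, ?_, fun h0 => hv0 (Subtype.ext h0), fun i j => ?_⟩
    · rintro rfl
      have hM : (Set.range fun i => M i) ⊆ {0} := by
        rintro _ ⟨i, rfl⟩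
        simp [← hx i]
      have := Submodule.span_mono (R := D) hM hv
      exact hv0 (Subtype.ext (by simpa using this))
    · simpa using (congrFun (hx i) j).symm
  · rintro ⟨x, y, hx, hy, hM⟩
    obtain ⟨i, hi⟩ := Function.ne_iff.1 hx
    have hspan : Submodule.span D (Set.range fun i => M i) = Submodule.span D {y} := by
      apply le_antisymm
      · rw [Submodule.span_le]
        rintro _ ⟨k, rfl⟩
        exact Submodule.mem_span_singleton.2 ⟨x k, by ext j; simp [hM]⟩
      · rw [Submodule.span_singleton_le_iff_mem]
        have : y = (x i)⁻¹ • M i := by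
          ext j
          simp only [Pi.smul_apply, smul_eq_mul, hM]
          rw [inv_mul_cancel_left₀ hi]
        rw [this]
        exact Submodule.smul_mem _ _ (Submodule.subset_span ⟨i, rfl⟩)
    rw [rowRank, hspan, finrank_span_singleton hy]

theorem RightIndep.rows_of_isRankOne {m n : ℕ} {a b : Fin m → D} (hab : RightIndep a b)
    {r s : Fin n → D} {M : Matrix (Fin m) (Fin n) D} (hM : IsRankOne M)
    (h : ∀ i j, M i j = a i * r j + b i * s j) :
    ∃ ρ σ, ∃ k : Fin n → D, ∀ j, r j = ρ * k j ∧ s j = σ * k j := by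
  obtain ⟨x, y, hx, hy, hxy⟩ := hM
  obtain ⟨l, hl⟩ := Function.ne_iff.1 hy
  refine ⟨r l, s l, fun j => (y l)⁻¹ * y j, fun j => ?_⟩
  have := hab (r j - r l * ((y l)⁻¹ * y j)) (s j - s l * ((y l)⁻¹ * y j)) fun i => by
    have h1 := h i j
    have h2 := h i l
    rw [hxy] at h1 h2
    have h3 : x i * y j = (a i * r l + b i * s l) * ((y l)⁻¹ * y j) := by
      rw [← h2, mul_assoc, mul_inv_cancel_left₀ hl]
    rw [h1] at h3
    rw [mul_sub, mul_sub, sub_add_sub_comm, h3, add_mul, mul_assoc, mul_assoc, sub_self]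
  exact ⟨sub_eq_zero.1 this.1, sub_eq_zero.1 this.2⟩

theorem col_or_row_of_isRankOne_sub {m n : ℕ} {x c : Fin m → D} {y : Fin n → D} {l : Fin n}
    (hc : c ≠ 0) {M : Matrix (Fin m) (Fin n) D} (hM : IsRankOne M)
    (h : ∀ i j, M i j = x i * y j - c i * unitRow l j) :
    (∃ s, ∀ i, x i = c i * s) ∨ ∀ j, j ≠ l → y j = 0 := by
  by_contra! hcon
  obtain ⟨hx, j, hj, hyj⟩ := hcon
  obtain ⟨x', y', -, -, hxy⟩ := hM
  have hxj : ∀ i, x i = x' i * (y' j * (y j)⁻¹) := fun i => by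
    have := h i j
    rw [hxy, unitRow_of_ne hj, mul_zero, sub_zero] at this
    rw [← mul_assoc, this, mul_inv_cancel_right₀ hyj]
  have hcl : ∀ i, c i = x' i * (y' j * (y j)⁻¹ * y l - y' l) := fun i => by
    have := h i l
    rw [hxy, unitRow_self, mul_one] at this
    rw [mul_sub, ← mul_assoc, ← hxj, this, sub_sub_cancel]
  set m := y' j * (y j)⁻¹ * y l - y' l
  have hm : m ≠ 0 := fun hm => hc (funext fun i => by simp [hcl, hm])
  obtain ⟨i, hi⟩ := hx (m⁻¹ * (y' j * (y j)⁻¹))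
  exact hi (by rw [hcl, mul_assoc, mul_inv_cancel_left₀ hm, hxj])

theorem col_proportional_of_isRankOne {m n : ℕ} {a b : Fin m → D} {k l : Fin n}
    {M : Matrix (Fin m) (Fin n) D} (hM : IsRankOne M) (ha : ∀ i, M i k = a i)
    (hb : ∀ i, M i l = b i) (hb0 : b ≠ 0) : ∃ s, ∀ i, a i = b i * s := by
  obtain ⟨x, y, -, -, hxy⟩ := hM
  have hy : y l ≠ 0 := fun hy => hb0 (funext fun i => by rw [← hb, hxy, hy, mul_zero]; rfl)
  exact ⟨(y l)⁻¹ * y k, fun i => by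
    rw [← hb, ← ha, hxy, hxy, mul_assoc, mul_inv_cancel_left₀ hy]⟩

@[simp]
theorem extendCol_castLE {p : ℕ} (u : Fin 2 → D) (i : Fin 2) :
    extendCol (p + 2) u (Fin.castLE (Nat.le_add_left 2 p) i) = u i :=
  dif_pos i.isLt

@[simp]
theorem extendCol_zero {p : ℕ} (i : Fin p) : extendCol p (0 : Fin 2 → D) i = 0 := by
  simp [extendCol]

theorem extendCol_ne_zero {p : ℕ} {u : Fin 2 → D} (hu : u ≠ 0) : extendCol (p + 2) u ≠ 0 := by
  intro h
  apply hu
  funext i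
  simpa using congrFun h (Fin.castLE (Nat.le_add_left 2 p) i)

theorem RightIndep.extendCol {p : ℕ} {u w : Fin 2 → D} (h : RightIndep u w) :
    RightIndep (extendCol (p + 2) u) (extendCol (p + 2) w) := by
  intro s t hst
  exact h s t fun i => by simpa using hst (Fin.castLE (Nat.le_add_left 2 p) i)

theorem extendCol_mul {p : ℕ} (w : Fin 2 → D) (s : D) (i : Fin p) :
    extendCol p (fun i => w i * s) i = extendCol p w i * s := by
  unfold extendCol
  split_ifs <;> simp

theorem extendCol_add_mul {p : ℕ} (u w : Fin 2 → D) (s : D) (i : Fin p) :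
    extendCol p (fun i => u i + w i * s) i = extendCol p u i + extendCol p w i * s := by
  unfold extendCol
  split_ifs <;> simp

theorem pad_twoCols {p q : ℕ} (u w : Fin 2 → D) (i : Fin p) (j : Fin (q + 2)) :
    pad p (q + 2) (twoCols u w) i j =
      extendCol p u i * unitRow 0 j +
        extendCol p w i * unitRow 1 j := by
  refine Fin.cases ?_ (fun j => Fin.cases ?_ (fun j => ?_) j) j
  · simp [pad, twoCols, extendCol]
  · simp [pad, twoCols, extendCol]
  · have h0 : j.succ.succ ≠ (0 : Fin (q + 2)) := Fin.succ_ne_zero _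
    have h1 : j.succ.succ ≠ (1 : Fin (q + 2)) := by
      simp [Fin.ext_iff]
    simp [pad, unitRow_of_ne h0, unitRow_of_ne h1]

theorem twoCols_eta {R : Type*} (A : Matrix (Fin 2) (Fin 2) R) :
    twoCols (fun i => A i 0) (fun i => A i 1) = A := by
  ext i j
  fin_cases j <;> rfl

theorem isRankOne_twoCols_sub_first {m : ℕ} {u u' w : Fin m → D} (h : u ≠ u') :
    IsRankOne (twoCols u w - twoCols u' w) := by
  refine ⟨fun i => u i - u' i, ![1, 0], sub_ne_zero.2 h, fun h => ?_, fun i j => ?_⟩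
  · simpa using congrFun h 0
  · fin_cases j <;> simp [twoCols]

theorem isRankOne_twoCols_sub_second {m : ℕ} {u w w' : Fin m → D} (h : w ≠ w') :
    IsRankOne (twoCols u w - twoCols u w') := by
  refine ⟨fun i => w i - w' i, ![0, 1], sub_ne_zero.2 h, fun h => ?_, fun i j => ?_⟩
  · simpa using congrFun h 1
  · fin_cases j <;> simp [twoCols]

theorem isRankOne_twoCols_sub_first_only {m : ℕ} {u w : Fin m → D} (hw : w ≠ 0) (s : D) :
    IsRankOne (twoCols u w - twoCols (fun i => u i + w i * s) 0) := by
  refine ⟨w, ![-s, 1], hw, fun h => ?_, fun i j => ?_⟩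
  · simpa using congrFun h 1
  · fin_cases j <;> simp [twoCols]

theorem isRankOne_twoCols_sub_second_only {m : ℕ} {u w : Fin m → D} (hu : u ≠ 0) (s : D) :
    IsRankOne (twoCols u w - twoCols 0 (fun i => w i + u i * s)) := by
  refine ⟨u, ![1, -s], hu, fun h => ?_, fun i j => ?_⟩
  · simpa using congrFun h 0
  · fin_cases j <;> simp [twoCols]

theorem RightIndep.left_ne_zero {m : ℕ} {u w : Fin m → D} (h : RightIndep u w) : u ≠ 0 := by
  rintro rfl
  simpa using h 1 0

theorem RightIndep.swap {m : ℕ} {u w : Fin m → D} (h : RightIndep u w) : RightIndep w u :=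
  fun s t hst => (h t s fun i => by rw [add_comm]; exact hst i).symm

theorem RightIndep.add_mul {m : ℕ} {u w : Fin m → D} (h : RightIndep u w) (x : D) :
    RightIndep u (fun i => w i + u i * x) := by
  intro s t hst
  have := h (s + x * t) t fun i => by
    rw [← hst i]
    noncomm_ring
  obtain ⟨h1, rfl⟩ := this
  simpa using h1

theorem exists_rightIndep {u : Fin 2 → D} (hu : u ≠ 0) : ∃ w : Fin 2 → D, RightIndep u w := by
  by_cases h0 : u 0 = 0
  · have h1 : u 1 ≠ 0 := fun h1 => hu (by ext i; fin_cases i <;> simp [h0, h1])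
    refine ⟨![1, 0], fun s t h => ?_⟩
    have ha := h 0
    have hb := h 1
    simp_all
  · refine ⟨![0, 1], fun s t h => ?_⟩
    have ha := h 0
    have hb := h 1
    simp_all

theorem exists_mul_eq_of_not_rightIndep {m : ℕ} {u w : Fin m → D} (hu : u ≠ 0)
    (h : ¬ RightIndep u w) : ∃ x, ∀ i, w i = u i * x := by
  unfold RightIndep at h
  push Not at h
  obtain ⟨s, t, hst, h⟩ := h
  have ht : t ≠ 0 := by
    rintro rfl
    obtain ⟨i, hi⟩ := Function.ne_iff.1 hu
    refine h ?_ rfl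
    simpa [show u i ≠ 0 from hi] using hst i
  refine ⟨-(s * t⁻¹), fun i => ?_⟩
  have := hst i
  rw [mul_neg, ← mul_assoc, eq_neg_of_add_eq_zero_left this, neg_mul, neg_neg,
    mul_inv_cancel_right₀ ht]

section AdjacencyPreserver

variable {p q : ℕ} {φ : Matrix (Fin 2) (Fin 2) D → Matrix (Fin (p + 2)) (Fin (q + 2)) D}

theorem first_col_or_add_second_col
    (hφ : ∀ A B, IsRankOne (A - B) → IsRankOne (φ A - φ B))
    (h1 : ∀ u, φ (twoCols u 0) = pad (p + 2) (q + 2) (twoCols u 0))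
    (u : Fin 2 → D) {w : Fin 2 → D} (hw : w ≠ 0) :
    (∃ z : Fin (p + 2) → D, ∀ i j, φ (twoCols u w) i j = z i * unitRow 0 j) ∨
      ∃ v : Fin (q + 2) → D, ∀ i j, φ (twoCols u w) i j =
        extendCol (p + 2) u i * unitRow 0 j + extendCol (p + 2) w i * v j := by
  have hA := hφ _ _ (isRankOne_twoCols_sub_first_only (u := u) hw 0)
  have hB := hφ _ _ (isRankOne_twoCols_sub_first_only (u := u) hw 1)
  rw [h1] at hA hB
  obtain ⟨x, y, -, -, hxy⟩ := hA
  simp only [Matrix.sub_apply, pad_twoCols, extendCol_zero, mul_zero, add_zero,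
    zero_mul] at hxy
  have hM : ∀ i j, φ (twoCols u w) i j = extendCol (p + 2) u i * unitRow 0 j + x i * y j :=
    fun i j => by rw [← hxy]; abel
  rcases col_or_row_of_isRankOne_sub (x := x) (y := y) (l := 0) (extendCol_ne_zero hw) hB
    (fun i j => by
      simp only [Matrix.sub_apply, pad_twoCols, extendCol_add_mul, extendCol_zero, hM]
      noncomm_ring) with ⟨s, hs⟩ | hy
  · exact Or.inr ⟨fun j => s * y j, fun i j => by rw [hM, hs, mul_assoc]⟩
  · refine Or.inl ⟨fun i => extendCol (p + 2) u i + x i * y 0, fun i j => ?_⟩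
    rw [hM]
    by_cases hj : j = 0
    · subst hj
      simp
    · simp [unitRow_of_ne hj, hy j hj]

theorem exists_image_second_col
    (hφ : ∀ A B, IsRankOne (A - B) → IsRankOne (φ A - φ B))
    (h1 : ∀ u, φ (twoCols u 0) = pad (p + 2) (q + 2) (twoCols u 0))
    (h2 : φ (twoCols 0 ![1, 0]) = pad (p + 2) (q + 2) (twoCols 0 ![1, 0]))
    {α : D} (hα : α ≠ 0)
    (h3 : φ (twoCols 0 ![0, 1]) = pad (p + 2) (q + 2) (twoCols 0 ![0, α]))
    {w : Fin 2 → D} (hw : w ≠ 0) :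
    ∃ s, s ≠ 0 ∧ φ (twoCols 0 w) = pad (p + 2) (q + 2) (twoCols 0 fun i => w i * s) := by
  by_cases hw1 : w = ![1, 0]
  · exact ⟨1, one_ne_zero, by simp [hw1, h2]⟩
  by_cases hw2 : w = ![0, 1]
  · refine ⟨α, hα, ?_⟩
    rw [hw2, h3]
    congr 2
    ext i
    fin_cases i <;> simp
  have hA := hφ _ _ (isRankOne_twoCols_sub_first_only (u := 0) hw 0)
  have hA' := hφ _ _ (isRankOne_twoCols_sub_first_only (u := 0) hw (-1))
  have hB := hφ _ _ (isRankOne_twoCols_sub_second (u := 0) hw1)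
  have hC := hφ _ _ (isRankOne_twoCols_sub_second (u := 0) hw2)
  rw [h1] at hA hA'
  rw [h2] at hB
  rw [h3] at hC
  obtain ⟨x, y, hx, hy, hxy⟩ := hA
  simp only [Matrix.sub_apply, pad_twoCols, extendCol_zero, mul_zero, add_zero,
    zero_mul, sub_zero] at hxy
  have hyj : ∀ j, j ≠ 1 → y j = 0 := by
    have hB' := col_or_row_of_isRankOne_sub (x := x) (y := y) (l := 1)
      (extendCol_ne_zero (u := ![1, 0]) fun h => by simpa using congrFun h 0) hB
      (fun i j => by simp [pad_twoCols, hxy])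
    have hC' := col_or_row_of_isRankOne_sub (x := x) (y := y) (l := 1)
      (extendCol_ne_zero (u := ![0, α]) fun h => hα (by simpa using congrFun h 1)) hC
      (fun i j => by simp [pad_twoCols, hxy])
    rcases hB' with ⟨s, hs⟩ | h
    · rcases hC' with ⟨t, ht⟩ | h
      · refine absurd (funext fun i => ?_) hx
        rw [hs]
        have hs0 : s = 0 := by
          have a := hs (Fin.castLE (Nat.le_add_left 2 p) 0)
          have b := ht (Fin.castLE (Nat.le_add_left 2 p) 0)
          simp only [extendCol_castLE] at a b
          simpa using a.symm.trans b
        simp [hs0]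
      · exact h
    · exact h
  have hy1 : y 1 ≠ 0 := fun h1 => hy (funext fun j => by
    by_cases hj : j = 1
    · rw [hj, h1]; rfl
    · exact hyj j hj)
  obtain ⟨s, hs⟩ := col_proportional_of_isRankOne (k := 1) (l := 0)
    (a := fun i => x i * y 1) (b := extendCol (p + 2) w) hA'
    (fun i => by simp [pad_twoCols, hxy])
    (fun i => by
      simp only [Matrix.sub_apply, pad_twoCols, extendCol_add_mul, hxy]
      simp [hyj 0 zero_ne_one])
    (extendCol_ne_zero hw)
  refine ⟨s, ?_, ?_⟩
  · rintro rfl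
    exact hx (funext fun i => by simpa [hy1] using hs i)
  · ext i j
    rw [hxy, pad_twoCols, extendCol_mul, ← hs]
    by_cases hj : j = 1
    · simp [hj]
    · simp [hyj j hj, unitRow_of_ne hj]

theorem eq_zero_or_image_of_rightIndep
    (hφ : ∀ A B, IsRankOne (A - B) → IsRankOne (φ A - φ B))
    (h1 : ∀ u, φ (twoCols u 0) = pad (p + 2) (q + 2) (twoCols u 0))
    {f : (Fin 2 → D) → D}
    (hf : ∀ w, w ≠ 0 →
      f w ≠ 0 ∧ φ (twoCols 0 w) = pad (p + 2) (q + 2) (twoCols 0 fun i => w i * f w))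
    {u w : Fin 2 → D} (huw : RightIndep u w) :
    φ (twoCols u w) = 0 ∨ ∃ ν, ∀ i j, φ (twoCols u w) i j =
      extendCol (p + 2) u i * unitRow 0 j +
        extendCol (p + 2) w i * (ν * unitRow 0 j + f w * unitRow 1 j) := by
  have hu := huw.left_ne_zero
  have hw := huw.swap.left_ne_zero
  have hA := hφ _ _ (isRankOne_twoCols_sub_second_only (w := w) hu 0)
  simp only [mul_zero, add_zero] at hA
  rw [(hf w hw).2] at hA
  rcases first_col_or_add_second_col hφ h1 u hw with ⟨z, hz⟩ | ⟨v, hv⟩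
  · left
    have huw1 := huw.add_mul 1
    have hw1 := huw1.swap.left_ne_zero
    have hB := hφ _ _ (isRankOne_twoCols_sub_second_only (w := w) hu 1)
    rw [(hf _ hw1).2] at hB
    have key : ∀ w' : Fin 2 → D, w' ≠ 0 →
        IsRankOne (φ (twoCols u w) - pad (p + 2) (q + 2) (twoCols 0 fun i => w' i * f w')) →
        ∃ s, ∀ i, z i = extendCol (p + 2) w' i * s := fun w' hw' h => by
      have hc : (fun i => w' i * -f w') ≠ 0 := fun h0 => hw' (funext fun i => by
        simpa [(hf w' hw').1] using congrFun h0 i)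
      obtain ⟨s, hs⟩ := col_proportional_of_isRankOne (k := 0) (l := 1) (a := z)
        (b := extendCol (p + 2) fun i => w' i * -f w') h
        (fun i => by simp [pad_twoCols, hz])
        (fun i => by simp only [Matrix.sub_apply, pad_twoCols, hz, extendCol_mul]; simp)
        (extendCol_ne_zero hc)
      exact ⟨-f w' * s, fun i => by rw [hs, extendCol_mul, mul_assoc]⟩
    obtain ⟨s, hs⟩ := key _ hw hA
    obtain ⟨t, ht⟩ := key _ hw1 hB
    have := huw.extendCol (p := p) (1 * t) (t - s) fun i => by
      have h := ht i
      rw [hs, extendCol_add_mul] at h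
      rw [mul_sub, h]
      noncomm_ring
    have ht0 : t = 0 := by simpa using this.1
    have hs0 : s = 0 := by simpa [ht0] using this.2
    ext i j
    simp [hz, hs, hs0]
  · right
    obtain ⟨ρ, σ, k, hk⟩ := huw.extendCol.rows_of_isRankOne hA
      (r := unitRow 0) (s := fun j => v j - f w * unitRow 1 j)
      (fun i j => by
        simp only [Matrix.sub_apply, pad_twoCols, hv, extendCol_mul, extendCol_zero]
        noncomm_ring)
    have h0 := (hk 0).1
    rw [unitRow_self] at h0
    have hρ : ρ ≠ 0 := by
      rintro rfl
      simp at h0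
    refine ⟨σ * ρ⁻¹, fun i j => ?_⟩
    rw [hv, (hk j).1, mul_assoc, inv_mul_cancel_left₀ hρ, ← (hk j).2, sub_add_cancel]

theorem image_of_rightIndep
    (hφ : ∀ A B, IsRankOne (A - B) → IsRankOne (φ A - φ B))
    (h1 : ∀ u, φ (twoCols u 0) = pad (p + 2) (q + 2) (twoCols u 0))
    {f : (Fin 2 → D) → D}
    (hf : ∀ w, w ≠ 0 →
      f w ≠ 0 ∧ φ (twoCols 0 w) = pad (p + 2) (q + 2) (twoCols 0 fun i => w i * f w))
    {u w : Fin 2 → D} (huw : RightIndep u w) :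
    ∃ ν, ∀ i j, φ (twoCols u w) i j =
      extendCol (p + 2) u i * unitRow 0 j +
        extendCol (p + 2) w i * (ν * unitRow 0 j + f w * unitRow 1 j) := by
  refine (eq_zero_or_image_of_rightIndep hφ h1 hf huw).resolve_left fun h0 => ?_
  have hw := huw.swap.left_ne_zero
  have huw' : RightIndep (fun i => u i + w i * 1) w := (huw.swap.add_mul 1).swap
  have hne : (fun i => u i + w i * 1) ≠ u := fun h => hw (funext fun i => by
    simpa using congrFun h i)
  have hA := hφ _ _ (isRankOne_twoCols_sub_first (w := w) hne)
  rw [h0, sub_zero] at hA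
  rcases eq_zero_or_image_of_rightIndep hφ h1 hf huw' with h | ⟨ν, hν⟩
  · obtain ⟨x, y, hx, hy, hxy⟩ := hA
    obtain ⟨i, hi⟩ := Function.ne_iff.1 hx
    obtain ⟨j, hj⟩ := Function.ne_iff.1 hy
    have := hxy i j
    rw [h] at this
    exact mul_ne_zero hi hj this.symm
  · obtain ⟨ρ, σ, k, hk⟩ := huw'.extendCol.rows_of_isRankOne hA hν
    have ha := (hk 1).1
    have hb := (hk 1).2
    have hc := (hk 0).1
    simp only [unitRow_self, unitRow_zero_one, mul_zero, zero_add, mul_one] at ha hb hc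
    rcases mul_eq_zero.1 ha.symm with h | h
    · simp [h] at hc
    · exact (hf w hw).1 (by rw [hb, h, mul_zero])

theorem scalar_and_image_of_rightIndep
    (hφ : ∀ A B, IsRankOne (A - B) → IsRankOne (φ A - φ B))
    (h1 : ∀ u, φ (twoCols u 0) = pad (p + 2) (q + 2) (twoCols u 0))
    {f : (Fin 2 → D) → D}
    (hf : ∀ w, w ≠ 0 →
      f w ≠ 0 ∧ φ (twoCols 0 w) = pad (p + 2) (q + 2) (twoCols 0 fun i => w i * f w))
    {u w : Fin 2 → D} (huw : RightIndep u w) :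
    (∀ x, f (fun i => w i + u i * x) = f w) ∧
      φ (twoCols u w) = pad (p + 2) (q + 2) (twoCols u fun i => w i * f w) := by
  obtain ⟨ν, hν⟩ := image_of_rightIndep hφ h1 hf huw
  have hu := huw.left_ne_zero
  have hw := huw.swap.left_ne_zero
  have key : ∀ x, f w - f (fun i => w i + u i * x) =
      -(ν * (x * f (fun i => w i + u i * x))) := by
    intro x
    have hB := hφ _ _ (isRankOne_twoCols_sub_second_only (w := w) hu x)
    rw [(hf _ (huw.add_mul x).swap.left_ne_zero).2] at hB
    set l := f (fun i => w i + u i * x)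
    obtain ⟨ρ, σ, k, hk⟩ := huw.extendCol.rows_of_isRankOne hB
      (r := fun j => unitRow 0 j - x * l * unitRow 1 j)
      (s := fun j => ν * unitRow 0 j + (f w - l) * unitRow 1 j)
      (fun i j => by
        simp only [Matrix.sub_apply, pad_twoCols, hν, extendCol_mul, extendCol_zero,
          extendCol_add_mul]
        noncomm_ring)
    have ha := hk 0
    have hb := hk 1
    simp only [unitRow_self, unitRow_zero_one, unitRow_one_zero, mul_zero, zero_add, mul_one,
      add_zero, sub_zero, zero_sub] at ha hb
    have hρ : ρ ≠ 0 := by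
      intro h
      simp [h] at ha
    have hk0 : k 0 = ρ⁻¹ := eq_inv_of_mul_eq_one_right ha.1.symm
    rw [hb.2, ← mul_neg, hb.1, ha.2, hk0, mul_assoc, inv_mul_cancel_left₀ hρ]
  have hν0 : ν = 0 := by
    by_contra h
    have := key ν⁻¹
    rw [mul_inv_cancel_left₀ h] at this
    exact (hf w hw).1 (by simpa [sub_eq_iff_eq_add] using this)
  refine ⟨fun x => ?_, ?_⟩
  · have := key x
    rw [hν0, zero_mul, neg_zero, sub_eq_zero] at this
    exact this.symm
  · ext i j
    rw [hν, pad_twoCols, extendCol_mul, hν0]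
    noncomm_ring

theorem image_eq_pad_of_dependent
    (hφ : ∀ A B, IsRankOne (A - B) → IsRankOne (φ A - φ B))
    (h1 : ∀ u, φ (twoCols u 0) = pad (p + 2) (q + 2) (twoCols u 0))
    (h2 : ∀ w, φ (twoCols 0 w) = pad (p + 2) (q + 2) (twoCols 0 w))
    (h : ∀ u w, RightIndep u w → φ (twoCols u w) = pad (p + 2) (q + 2) (twoCols u w))
    {u w : Fin 2 → D} (hu : u ≠ 0) (hw : w ≠ 0) {x : D} (hx : ∀ i, w i = u i * x) :
    φ (twoCols u w) = pad (p + 2) (q + 2) (twoCols u w) := by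
  obtain ⟨u', hu'⟩ := exists_rightIndep hu
  have hx0 : x ≠ 0 := by
    rintro rfl
    exact hw (funext fun i => by simp [hx])
  have hwu' : RightIndep u' w := fun s t hst => by
    have := hu' (x * t) s fun i => by
      rw [← hst i, hx, add_comm, mul_assoc]
    simpa [hx0, and_comm] using this
  have hne : u ≠ u' := by
    rintro rfl
    simpa using hu' 1 (-1) fun i => by simp
  have hne' : w ≠ u' := by
    rintro rfl
    simpa using hwu' 1 (-1) fun i => by simp
  have hA := hφ _ _ (isRankOne_twoCols_sub_first (w := w) hne)
  have hB := hφ _ _ (isRankOne_twoCols_sub_second (u := u) hne')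
  have hC := hφ _ _ (isRankOne_twoCols_sub_first (w := w) hu)
  rw [h _ _ hwu'] at hA
  rw [h _ _ hu'] at hB
  rw [h2] at hC
  have hnw : (fun i => w i * -1) ≠ 0 := fun h0 => hw (funext fun i => by
    simpa using congrFun h0 i)
  have hxE : ∀ i, extendCol (p + 2) w i = extendCol (p + 2) u i * x := fun i => by
    rw [← extendCol_mul, funext hx]
  rcases first_col_or_add_second_col hφ h1 u hw with ⟨z, hz⟩ | ⟨v, hv⟩
  · exfalso
    obtain ⟨s, hs⟩ := col_proportional_of_isRankOne (k := 0) (l := 1)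
      (a := fun i => z i - extendCol (p + 2) u' i)
      (b := extendCol (p + 2) fun i => w i * -1) hA
      (fun i => by simp [pad_twoCols, hz])
      (fun i => by simp only [Matrix.sub_apply, pad_twoCols, hz, extendCol_mul]; simp)
      (extendCol_ne_zero hnw)
    obtain ⟨t, ht⟩ := col_proportional_of_isRankOne (k := 0) (l := 1) (a := z)
      (b := extendCol (p + 2) fun i => w i * -1) hC
      (fun i => by simp [pad_twoCols, hz])
      (fun i => by simp only [Matrix.sub_apply, pad_twoCols, hz, extendCol_mul]; simp)
      (extendCol_ne_zero hnw)
    have := hwu'.extendCol (p := p) 1 (t - s) fun i => by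
      have h := hs i
      rw [ht, extendCol_mul] at h
      rw [mul_one, ← sub_sub_cancel (extendCol (p + 2) w i * -1 * t) (extendCol (p + 2) u' i), h]
      noncomm_ring
    simp at this
  · obtain ⟨ρ, σ, k, hk⟩ := hu'.extendCol.rows_of_isRankOne hA
      (r := fun j => unitRow 0 j + x * v j - x * unitRow 1 j) (s := fun j => -unitRow 0 j)
      (fun i j => by
        simp only [Matrix.sub_apply, pad_twoCols, hv, hxE]
        noncomm_ring)
    have hσ : σ ≠ 0 := by
      intro h
      simpa [h] using (hk 0).2
    have hvj : ∀ j, j ≠ 0 → v j = unitRow 1 j := fun j hj => by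
      have h := hk j
      simp only [unitRow_of_ne hj, neg_zero, zero_add] at h
      have hkj : k j = 0 := by simpa [hσ] using h.2.symm
      have h1 := h.1
      rw [hkj, mul_zero, ← mul_sub] at h1
      exact sub_eq_zero.1 ((mul_eq_zero.1 h1).resolve_left hx0)
    obtain ⟨ρ', σ', k', hk'⟩ := hwu'.swap.extendCol.rows_of_isRankOne hB
      (r := v) (s := fun j => -unitRow 1 j)
      (fun i j => by
        simp only [Matrix.sub_apply, pad_twoCols, hv]
        noncomm_ring)
    have hσ' : σ' ≠ 0 := by
      intro h
      simpa [h] using (hk' 1).2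
    have hv0 : v 0 = 0 := by
      have h := hk' 0
      have hk0 : k' 0 = 0 := by simpa [hσ'] using h.2
      rw [h.1, hk0, mul_zero]
    ext i j
    rw [hv, pad_twoCols]
    by_cases hj : j = 0
    · simp [hj, hv0]
    · rw [hvj j hj]

theorem scalar_eq_one
    {f : (Fin 2 → D) → D} (hf1 : f ![1, 0] = 1)
    (hf : ∀ u w, RightIndep u w → f (fun i => w i + u i * 1) = f w)
    {w : Fin 2 → D} (hw : w ≠ 0) : f w = 1 := by
  have key : ∀ w : Fin 2 → D, w 1 ≠ 0 → f w = 1 := fun w hw1 => by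
    rw [← hf1, ← hf ![w 0 - 1, w 1] ![1, 0] fun s t h => ?_]
    · congr 1
      ext i
      fin_cases i <;> simp
    · have hs : s = 0 := by simpa [hw1] using h 1
      subst hs
      simpa using h 0
  by_cases hw1 : w 1 = 0
  · have hw0 : w 0 ≠ 0 := fun h => hw (by ext i; fin_cases i <;> simp [h, hw1])
    rw [← key ![0, 1] (by simp), ← hf ![w 0, -1] ![0, 1] fun s t h => ?_]
    · congr 1
      ext i
      fin_cases i <;> simp [hw1]
    · have hs : s = 0 := by simpa [hw0] using h 0
      subst hs
      simpa using h 1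
  · exact key w hw1

theorem eq_pad_of_isRankOne_preserver
    (hφ : ∀ A B, IsRankOne (A - B) → IsRankOne (φ A - φ B))
    (h1 : ∀ u, φ (twoCols u 0) = pad (p + 2) (q + 2) (twoCols u 0))
    (h2 : φ (twoCols 0 ![1, 0]) = pad (p + 2) (q + 2) (twoCols 0 ![1, 0]))
    {α : D} (hα : α ≠ 0)
    (h3 : φ (twoCols 0 ![0, 1]) = pad (p + 2) (q + 2) (twoCols 0 ![0, α]))
    (A : Matrix (Fin 2) (Fin 2) D) : φ A = pad (p + 2) (q + 2) A := by
  have hex : ∀ w : Fin 2 → D, ∃ s, w ≠ 0 → s ≠ 0 ∧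
      φ (twoCols 0 w) = pad (p + 2) (q + 2) (twoCols 0 fun i => w i * s) := fun w => by
    by_cases hw : w = 0
    · exact ⟨0, fun h => absurd hw h⟩
    · obtain ⟨s, hs⟩ := exists_image_second_col hφ h1 h2 hα h3 hw
      exact ⟨s, fun _ => hs⟩
  choose f hf using hex
  have hf1 : f ![1, 0] = 1 := by
    have h := (hf ![1, 0] fun h => by simpa using congrFun h 0).2
    rw [h2] at h
    have := congrFun (congrFun h (Fin.castLE (Nat.le_add_left 2 p) 0)) 1
    simp only [pad_twoCols, extendCol_castLE] at this
    simpa using this.symm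
  have hfw : ∀ w, w ≠ 0 → f w = 1 := fun w hw => scalar_eq_one hf1
    (fun u w huw => (scalar_and_image_of_rightIndep hφ h1 hf huw).1 1) hw
  have hsnd : ∀ w, φ (twoCols 0 w) = pad (p + 2) (q + 2) (twoCols 0 w) := fun w => by
    by_cases hw : w = 0
    · rw [hw, h1]
    · simpa [hfw w hw] using (hf w hw).2
  have hind : ∀ u w, RightIndep u w →
      φ (twoCols u w) = pad (p + 2) (q + 2) (twoCols u w) := fun u w huw => by
    simpa [hfw w huw.swap.left_ne_zero] using
      (scalar_and_image_of_rightIndep hφ h1 hf huw).2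
  rw [← twoCols_eta A]
  generalize (fun i => A i 0) = u
  generalize (fun i => A i 1) = w
  by_cases hu : u = 0
  · rw [hu, hsnd]
  by_cases hw : w = 0
  · rw [hw, h1]
  by_cases huw : RightIndep u w
  · exact hind u w huw
  obtain ⟨x, hx⟩ := exists_mul_eq_of_not_rightIndep hu huw
  exact image_eq_pad_of_dependent hφ h1 hsnd hind hu hw hx

end AdjacencyPreserver

/-- Lemma 3.14. -/
theorem stmt11 (hEAS : EAS D) (p q : ℕ) (hp : 2 ≤ p) (hq : 2 ≤ q)
    (φ : Matrix (Fin 2) (Fin 2) D → Matrix (Fin p) (Fin q) D)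
    (hφ : ∀ A B, Adjacent A B → Adjacent (φ A) (φ B))
    (α : D) (hα : α ≠ 0)
    (h1 : ∀ a b : D, φ !![a, 0; b, 0] = pad p q !![a, 0; b, 0])
    (h2 : φ !![0, 1; 0, 0] = pad p q !![(0 : D), 1; 0, 0])
    (h3 : φ !![0, 0; 0, 1] = pad p q !![(0 : D), 0; 0, α]) :
    ∀ A : Matrix (Fin 2) (Fin 2) D, φ A = pad p q A := by
  obtain ⟨p, rfl⟩ := Nat.exists_eq_add_of_le' hp
  obtain ⟨q, rfl⟩ := Nat.exists_eq_add_of_le' hq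
  have hcols : ∀ a b c d : D, twoCols ![a, b] ![c, d] = !![a, c; b, d] := fun a b c d => by
    ext i j
    fin_cases i <;> fin_cases j <;> rfl
  have hzero : (0 : Fin 2 → D) = ![0, 0] := by
    ext i
    fin_cases i <;> rfl
  refine eq_pad_of_isRankOne_preserver (α := α) (fun A B h => ?_) (fun u => ?_) ?_ hα ?_
  · exact (rowRank_eq_one_iff _).1 (hφ A B ((rowRank_eq_one_iff _).2 h))
  · have hu : u = ![u 0, u 1] := by
      ext i
      fin_cases i <;> rfl
    rw [hu, hzero, hcols, h1]
  · rw [hzero, hcols, h2]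
  · rw [hzero, hcols, hcols, h3]
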